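/- Let α be a linear automorphism of a finite-dimensional vector space E over a local field K. Then the contraction group U_α = {x ∈ E : αⁿ(x) → 0} equals the sum of the subspaces E_ρ with ρ < 1, the Levi factor M_α = {x ∈ E : {αⁿ(x) : n ∈ ℤ} is relatively compact} equals E_1, and U_{α⁻¹} equals the sum of E_ρ with ρ > 1; moreover E = U_α ⊕ M_α ⊕ U_{α⁻¹}. -/

import Mathlib

open Filter Topology
open scoped TensorProduct

/-- The base change of a linear endomorphism to the algebraic closure. -/
noncomputable def baseChangeEnd {K : Type*} [NontriviallyNormedField K]
    {E : Type*} [AddCommGroup E] [Module K E] (α : E →ₗ[K] E) :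
    Module.End (AlgebraicClosure K) (AlgebraicClosure K ⊗[K] E) :=
  LinearMap.baseChange (AlgebraicClosure K) α

/-- `R(α)`: the set of absolute values of eigenvalues of `α` over the algebraic closure. -/
def eigAbs {K : Type*} [NontriviallyNormedField K] {E : Type*} [AddCommGroup E] [Module K E]
    (v : AbsoluteValue (AlgebraicClosure K) ℝ) (α : E →ₗ[K] E) : Set ℝ :=
  {r : ℝ | ∃ μ : AlgebraicClosure K, (baseChangeEnd α).HasEigenvalue μ ∧ v μ = r}

/-- `E_ρ`: the `α`-invariant `K`-subspace of `E` corresponding to all eigenvalues of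
absolute value `ρ`. -/
noncomputable def specSubspace {K : Type*} [NontriviallyNormedField K] {E : Type*}
    [AddCommGroup E] [Module K E] (v : AbsoluteValue (AlgebraicClosure K) ℝ)
    (α : E →ₗ[K] E) (ρ : ℝ) : Submodule K E :=
  Submodule.comap ((TensorProduct.mk K (AlgebraicClosure K) E) 1)
    (Submodule.restrictScalars K
      (⨆ μ ∈ {μ : AlgebraicClosure K | v μ = ρ}, (baseChangeEnd α).maxGenEigenspace μ))

section Helpers

/-- A locally compact totally disconnected normed field has bounded naturals. -/
lemma norm_natCast_le_one_of_td {K : Type*} [NontriviallyNormedField K]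
    [LocallyCompactSpace K] [TotallyDisconnectedSpace K] (n : ℕ) : ‖(n : K)‖ ≤ 1 := by
  haveI : ProperSpace K := ProperSpace.of_locallyCompactSpace K
  obtain ⟨W, hW, h0, hWb⟩ := (loc_compact_Haus_tot_disc_of_zero_dim (H := K)).exists_subset_of_mem_open
    (show (0 : K) ∈ Metric.ball 0 1 by simp) Metric.isOpen_ball
  have hWc : IsCompact W :=
    Metric.isCompact_of_isClosed_isBounded hW.1 (Metric.isBounded_ball.subset hWb)
  obtain ⟨δ, hδ, hsub⟩ := hWc.exists_thickening_subset_open hW.2 subset_rfl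
  obtain ⟨c, hc0, hc⟩ := NormedField.exists_norm_lt K hδ
  have hmem : ∀ m : ℕ, (m : K) * c ∈ W := by
    intro m
    induction m with
    | zero => simpa using h0
    | succ m ih =>
      apply hsub
      rw [Metric.mem_thickening_iff]
      refine ⟨_, ih, ?_⟩
      rw [dist_eq_norm]
      have : ((m + 1 : ℕ) : K) * c - m * c = c := by push_cast; ring
      rwa [this]
  by_contra hn
  push Not at hn
  obtain ⟨k, hk⟩ := pow_unbounded_of_one_lt (1 / ‖c‖) hn
  have h1 := hWb (hmem (n ^ k))
  rw [mem_ball_zero_iff, norm_mul, Nat.cast_pow, norm_pow] at h1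
  rw [div_lt_iff₀ hc0] at hk
  linarith

/-- Comparison of a seminorm with a norm on a finite-dimensional space. -/
lemma seminorm_le_of_norm {K V : Type*} [NontriviallyNormedField K] [CompleteSpace K]
    [AddCommGroup V] [Module K V] [FiniteDimensional K V] (f g : Seminorm K V)
    (hf : ∀ x, f x = 0 → x = 0) : ∃ C : ℝ, ∀ x, g x ≤ C * f x := by
  letI : NormedAddCommGroup V :=
    AddGroupNorm.toNormedAddCommGroup
      { toFun := f
        map_zero' := map_zero f
        add_le' := map_add_le_add f
        neg' := map_neg_eq_map f
        eq_zero_of_map_eq_zero' := hf }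
  have hnorm : ∀ x : V, ‖x‖ = f x := fun x => rfl
  letI : NormedSpace K V := { norm_smul_le := fun a x => by
                                rw [hnorm, hnorm, map_smul_eq_mul] }
  let b := Module.finBasis K V
  let L : V →L[K] (Fin (Module.finrank K V) → K) := LinearMap.toContinuousLinearMap b.equivFun
  refine ⟨∑ i, ‖L‖ * g (b i), fun x => ?_⟩
  have hx : x = ∑ i, (L x i) • b i := (b.sum_equivFun x).symm
  calc g x = g (∑ i, (L x i) • b i) := by rw [← hx]
    _ ≤ ∑ i, g ((L x i) • b i) := Finset.le_sum_of_subadditive g (map_zero g).le (map_add_le_add g) _ _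
    _ ≤ ∑ i, ‖L‖ * g (b i) * f x := by
        refine Finset.sum_le_sum fun i _ => ?_
        rw [map_smul_eq_mul]
        have h1 : ‖L x i‖ ≤ ‖L‖ * f x := (norm_le_pi_norm (L x) i).trans (L.le_opNorm x)
        calc _ ≤ ‖L‖ * f x * g (b i) := mul_le_mul_of_nonneg_right h1 (apply_nonneg g _)
          _ = _ := by ring
    _ = _ := by rw [Finset.sum_mul]

lemma le_of_pow_le_mul_pow {a b C : ℝ} (hb : 0 ≤ b)
    (h : ∀ n : ℕ, a ^ n ≤ C * b ^ n) : a ≤ b := by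
  by_contra hlt
  push Not at hlt
  rcases hb.eq_or_lt with rfl | hb
  · have := h 1
    simp at this
    linarith
  · have h1 : 1 < a / b := by rwa [one_lt_div hb]
    obtain ⟨k, hk⟩ := pow_unbounded_of_one_lt C h1
    rw [div_pow, lt_div_iff₀ (by positivity)] at hk
    exact absurd (h k) (not_le.mpr hk)

section
variable {K : Type*} [NontriviallyNormedField K] [CompleteSpace K]
    (v : AbsoluteValue (AlgebraicClosure K) ℝ)
    (hvext : ∀ t : K, v (algebraMap K (AlgebraicClosure K) t) = ‖t‖)

/-- The seminorm induced by `v` along a linear map. -/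
noncomputable def absSeminorm {V : Type*} [AddCommGroup V] [Module K V]
    (hvext : ∀ t : K, v (algebraMap K (AlgebraicClosure K) t) = ‖t‖)
    (φ : V →ₗ[K] AlgebraicClosure K) : Seminorm K V :=
  Seminorm.of (fun x => v (φ x)) (fun x y => by rw [map_add]; exact v.add_le _ _)
    (fun a x => by rw [map_smul, Algebra.smul_def, v.map_mul, hvext])

include hvext in
lemma abs_conj_le (σ : AlgebraicClosure K ≃ₐ[K] AlgebraicClosure K) (μ : AlgebraicClosure K) :
    v (σ μ) ≤ v μ := by
  have hint : IsIntegral K μ := Algebra.IsIntegral.isIntegral μ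
  haveI : FiniteDimensional K (IntermediateField.adjoin K {μ}) :=
    IntermediateField.adjoin.finiteDimensional hint
  let φ : IntermediateField.adjoin K {μ} →ₗ[K] AlgebraicClosure K :=
    (IntermediateField.adjoin K {μ}).val.toLinearMap
  obtain ⟨C, hC⟩ := seminorm_le_of_norm (absSeminorm v hvext φ)
    (absSeminorm v hvext (σ.toLinearMap ∘ₗ φ)) (fun x hx => by
      have : v (φ x) = 0 := hx
      rw [v.eq_zero] at this
      exact Subtype.ext this)
  refine le_of_pow_le_mul_pow (C := C) (v.nonneg _) fun n => ?_
  have := hC ((IntermediateField.AdjoinSimple.gen K μ) ^ n)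
  have h1 : absSeminorm v hvext φ ((IntermediateField.AdjoinSimple.gen K μ) ^ n) = v μ ^ n := by
    change v (((IntermediateField.AdjoinSimple.gen K μ) ^ n : IntermediateField.adjoin K {μ}) :
      AlgebraicClosure K) = _
    rw [← v.map_pow]; simp
  have h2 : absSeminorm v hvext (σ.toLinearMap ∘ₗ φ)
      ((IntermediateField.AdjoinSimple.gen K μ) ^ n) = v (σ μ) ^ n := by
    change v (σ (((IntermediateField.AdjoinSimple.gen K μ) ^ n : IntermediateField.adjoin K {μ}) :
      AlgebraicClosure K)) = _
    rw [← v.map_pow, ← map_pow]; simp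
  rwa [h1, h2] at this

include hvext in
lemma abs_eq_of_root {p : Polynomial K} (hp : Irreducible p) {μ ν : AlgebraicClosure K}
    (hμ : Polynomial.aeval μ p = 0) (hν : Polynomial.aeval ν p = 0) : v μ = v ν := by
  have hc : IsConjRoot K μ ν := by
    rw [IsConjRoot, ← minpoly.eq_of_irreducible hp hμ, ← minpoly.eq_of_irreducible hp hν]
  obtain ⟨σ, rfl⟩ := isConjRoot_iff_exists_algEquiv.mp hc
  refine le_antisymm (abs_conj_le v hvext σ ν) ?_
  simpa using abs_conj_le v hvext σ.symm (σ ν)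

end

/-- Primary decomposition bound. -/
lemma ker_aeval_le_of_prime_pow {F M : Type*} [Field F] [AddCommGroup M] [Module F M]
    (A : Module.End F M) (S : Submodule F M) (g : Polynomial F) (hg : g ≠ 0)
    (H : ∀ p : Polynomial F, Prime p → p ∣ g → ∀ k : ℕ,
      LinearMap.ker (Polynomial.aeval A (p ^ k)) ≤ S) :
    LinearMap.ker (Polynomial.aeval A g) ≤ S := by
  induction g using UniqueFactorizationMonoid.induction_on_coprime with
  | h0 => exact absurd rfl hg
  | h1 hu =>
    intro x hx
    obtain ⟨u, rfl⟩ := hu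
    have h1 : Polynomial.aeval A (((u⁻¹ : (Polynomial F)ˣ) : Polynomial F) * (u : Polynomial F)) x = x := by
      simp
    rw [map_mul, Module.End.mul_apply, LinearMap.mem_ker.mp hx, map_zero] at h1
    rw [← h1]; exact S.zero_mem
  | hpr i hp =>
    rcases Nat.eq_zero_or_pos i with rfl | hi
    · intro x hx
      simp at hx
      rw [hx]; exact S.zero_mem
    · exact H _ hp (dvd_pow_self _ hi.ne') _
  | hcp hrel hx hy =>
    rw [← Polynomial.sup_ker_aeval_eq_ker_aeval_mul_of_coprime _ (hrel.isCoprime)]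
    refine sup_le (hx (left_ne_zero_of_mul hg) fun p hp hd => H p hp (hd.mul_right _))
      (hy (right_ne_zero_of_mul hg) fun p hp hd => H p hp (hd.mul_left _))


lemma baseChange_pow_tmul {K E : Type*} [NontriviallyNormedField K] [AddCommGroup E] [Module K E]
    (α : E →ₗ[K] E) (n : ℕ) (x : E) :
    (baseChangeEnd α ^ n) (1 ⊗ₜ[K] x) = 1 ⊗ₜ[K] ((α ^ n) x) := by
  rw [baseChangeEnd, ← LinearMap.baseChange_pow, LinearMap.baseChange_tmul]

lemma aeval_baseChange_tmul {K E : Type*} [NontriviallyNormedField K] [AddCommGroup E] [Module K E]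
    (α : E →ₗ[K] E) (p : Polynomial K) (x : E) :
    Polynomial.aeval (baseChangeEnd α) (p.map (algebraMap K (AlgebraicClosure K))) (1 ⊗ₜ[K] x)
      = 1 ⊗ₜ[K] (Polynomial.aeval α p x) := by
  rw [Polynomial.aeval_map_algebraMap]
  induction p using Polynomial.induction_on' with
  | add p q hp hq => simp only [map_add, LinearMap.add_apply, hp, hq, TensorProduct.tmul_add]
  | monomial n a =>
    simp only [Polynomial.aeval_monomial, Module.End.mul_apply, baseChange_pow_tmul,
      Module.algebraMap_end_apply, TensorProduct.tmul_smul]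

lemma mk_one_injective {K E : Type*} [NontriviallyNormedField K] [AddCommGroup E] [Module K E]
    {x : E} (h : (1 : AlgebraicClosure K) ⊗ₜ[K] x = 0) : x = 0 := by
  apply Module.FaithfullyFlat.tensorProduct_mk_injective (A := K) (B := AlgebraicClosure K) E
  simpa using h

/-- `E_ρ` is trivial when `ρ` is not the absolute value of an eigenvalue. -/
lemma specSubspace_eq_bot {K E : Type*} [NontriviallyNormedField K] [AddCommGroup E] [Module K E]
    [FiniteDimensional K E]
    (v : AbsoluteValue (AlgebraicClosure K) ℝ) (α : E →ₗ[K] E) (ρ : ℝ) (h : ρ ∉ eigAbs v α) :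
    specSubspace v α ρ = ⊥ := by
  rw [eq_bot_iff]
  intro x hx
  have h0 : (⨆ μ ∈ {μ : AlgebraicClosure K | v μ = ρ}, (baseChangeEnd α).maxGenEigenspace μ) = ⊥ := by
    rw [eq_bot_iff]
    refine iSup₂_le fun μ hμ => ?_
    by_contra hne
    apply h
    refine ⟨μ, ?_, hμ⟩
    have h1 : (baseChangeEnd α).HasUnifEigenvalue μ ⊤ := by
      rw [Module.End.HasUnifEigenvalue]
      exact fun hh => hne (le_of_eq hh)
    exact h1.lt (by simp)
  rw [specSubspace, h0] at hx
  simpa using hx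

lemma ker_prime_pow_le {K E : Type*} [NontriviallyNormedField K] [CompleteSpace K]
    [AddCommGroup E] [Module K E]
    (v : AbsoluteValue (AlgebraicClosure K) ℝ)
    (hvext : ∀ t : K, v (algebraMap K (AlgebraicClosure K) t) = ‖t‖)
    (α : E →ₗ[K] E) (p : Polynomial K) (hp : Prime p) (k : ℕ) :
    ∃ ρ, LinearMap.ker (Polynomial.aeval α (p ^ k)) ≤ specSubspace v α ρ := by
  have hirr := hp.irreducible
  obtain ⟨ν, hν⟩ := IsAlgClosed.exists_aeval_eq_zero (AlgebraicClosure K) p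
    (Polynomial.degree_pos_of_irreducible hirr).ne'
  refine ⟨v ν, fun x hx => ?_⟩
  rw [specSubspace, Submodule.mem_comap, Submodule.restrictScalars_mem]
  have hk : (1 : AlgebraicClosure K) ⊗ₜ[K] x ∈ LinearMap.ker (Polynomial.aeval (baseChangeEnd α)
      ((p ^ k).map (algebraMap K (AlgebraicClosure K)))) := by
    rw [LinearMap.mem_ker, aeval_baseChange_tmul, LinearMap.mem_ker.mp hx, TensorProduct.tmul_zero]
  refine ker_aeval_le_of_prime_pow _ _ _ ?_ ?_ hk
  · rw [Polynomial.map_ne_zero_iff (algebraMap K (AlgebraicClosure K)).injective]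
    exact pow_ne_zero _ hp.ne_zero
  · intro q hq hqd j y hy
    obtain ⟨μ, hμ⟩ := IsAlgClosed.exists_aeval_eq_zero (AlgebraicClosure K) q
      (Polynomial.degree_pos_of_irreducible hq.irreducible).ne'
    have hroot : q.IsRoot μ := by simpa [Polynomial.aeval_def] using hμ
    have hdvd := Polynomial.dvd_iff_isRoot.mpr hroot
    have hass : Associated (Polynomial.X - Polynomial.C μ) q :=
      (Polynomial.prime_X_sub_C μ).associated_of_dvd hq hdvd
    have hpμ : Polynomial.aeval μ p = 0 := by
      rw [Polynomial.map_pow] at hqd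
      have h2 := hdvd.trans (hq.dvd_of_dvd_pow hqd)
      rw [Polynomial.dvd_iff_isRoot] at h2
      rwa [Polynomial.aeval_def, ← Polynomial.eval_map]
    have hv : v μ = v ν := abs_eq_of_root v hvext hirr hpμ hν
    refine Submodule.mem_iSup_of_mem μ (Submodule.mem_iSup_of_mem hv ?_)
    rw [Module.End.mem_maxGenEigenspace]
    refine ⟨j, ?_⟩
    obtain ⟨r, hr⟩ := (hass.symm.dvd.trans dvd_rfl : q ∣ Polynomial.X - Polynomial.C μ)
    have h3 : Polynomial.aeval (baseChangeEnd α) ((Polynomial.X - Polynomial.C μ) ^ j) y = 0 := by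
      rw [hr, mul_pow, mul_comm, map_mul, Module.End.mul_apply, LinearMap.mem_ker.mp hy, map_zero]
    simpa [Algebra.algebraMap_eq_smul_one] using h3

lemma iSup_specSubspace {K E : Type*} [NontriviallyNormedField K] [CompleteSpace K]
    [AddCommGroup E] [Module K E] [FiniteDimensional K E]
    (v : AbsoluteValue (AlgebraicClosure K) ℝ)
    (hvext : ∀ t : K, v (algebraMap K (AlgebraicClosure K) t) = ‖t‖)
    (α : E →ₗ[K] E) : (⨆ ρ, specSubspace v α ρ) = ⊤ := by
  rw [eq_top_iff]
  have h : LinearMap.ker (Polynomial.aeval α (minpoly K α)) ≤ ⨆ ρ, specSubspace v α ρ := by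
    refine ker_aeval_le_of_prime_pow _ _ _
      (minpoly.ne_zero (Algebra.IsIntegral.isIntegral α)) fun p hp _ k => ?_
    obtain ⟨ρ, hρ⟩ := ker_prime_pow_le v hvext α p hp k
    exact hρ.trans (le_iSup _ ρ)
  simpa using h

lemma spec_sup_eq_top {K E : Type*} [NontriviallyNormedField K] [CompleteSpace K]
    [AddCommGroup E] [Module K E] [FiniteDimensional K E]
    (v : AbsoluteValue (AlgebraicClosure K) ℝ)
    (hvext : ∀ t : K, v (algebraMap K (AlgebraicClosure K) t) = ‖t‖)
    (α : E →ₗ[K] E) :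
    (⨆ ρ ∈ {ρ ∈ eigAbs v α | ρ < 1}, specSubspace v α ρ) ⊔ specSubspace v α 1 ⊔
      (⨆ ρ ∈ {ρ ∈ eigAbs v α | 1 < ρ}, specSubspace v α ρ) = ⊤ := by
  rw [eq_top_iff, ← iSup_specSubspace v hvext α]
  refine iSup_le fun ρ => ?_
  by_cases hρ : ρ ∈ eigAbs v α
  · rcases lt_trichotomy ρ 1 with h | rfl | h
    · exact le_sup_of_le_left (le_sup_of_le_left
        (le_iSup₂_of_le (f := fun ρ _ => specSubspace v α ρ) ρ ⟨hρ, h⟩ le_rfl))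
    · exact le_sup_of_le_left le_sup_right
    · exact le_sup_of_le_right
        (le_iSup₂_of_le (f := fun ρ _ => specSubspace v α ρ) ρ ⟨hρ, h⟩ le_rfl)
  · rw [specSubspace_eq_bot v α ρ hρ]; exact bot_le

lemma maxGen_inv {F M : Type*} [Field F] [AddCommGroup M] [Module F M] (A B : Module.End F M)
    (hBA : B * A = 1) (hAB : A * B = 1) (μ : F) (hμ0 : μ ≠ 0) :
    A.maxGenEigenspace μ ≤ B.maxGenEigenspace μ⁻¹ := by
  intro y hy
  rw [Module.End.mem_maxGenEigenspace] at hy ⊢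
  obtain ⟨k, hk⟩ := hy
  refine ⟨k, ?_⟩
  have e : B - μ⁻¹ • 1 = (-(μ⁻¹) • B) * (A - μ • 1) := by
    rw [mul_sub, smul_mul_assoc, hBA, smul_mul_smul_comm]
    simp [hμ0]
    abel
  have hc : Commute (-(μ⁻¹) • B) (A - μ • 1) := by
    have : Commute B A := hBA.trans hAB.symm
    exact (this.sub_right ((Commute.one_right B).smul_right μ)).smul_left _
  rw [e, hc.mul_pow, Module.End.mul_apply, hk, map_zero]

/-- Passing to the inverse inverts the eigenvalue absolute values. -/
lemma specSubspace_inv {K E : Type*} [NontriviallyNormedField K]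
    [AddCommGroup E] [Module K E]
    (v : AbsoluteValue (AlgebraicClosure K) ℝ)
    (α β : E →ₗ[K] E) (h : β * α = 1) (h' : α * β = 1) (ρ : ℝ) (hρ : 0 < ρ) :
    specSubspace v α ρ ≤ specSubspace v β ρ⁻¹ := by
  refine Submodule.comap_mono ?_
  change (⨆ μ ∈ {μ : AlgebraicClosure K | v μ = ρ}, (baseChangeEnd α).maxGenEigenspace μ) ≤
    (⨆ μ ∈ {μ : AlgebraicClosure K | v μ = ρ⁻¹}, (baseChangeEnd β).maxGenEigenspace μ)
  have hBA : baseChangeEnd β * baseChangeEnd α = 1 := by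
    rw [baseChangeEnd, baseChangeEnd, ← LinearMap.baseChange_mul, h, LinearMap.baseChange_one]
  have hAB : baseChangeEnd α * baseChangeEnd β = 1 := by
    rw [baseChangeEnd, baseChangeEnd, ← LinearMap.baseChange_mul, h', LinearMap.baseChange_one]
  refine iSup₂_le fun μ hμ => ?_
  have hμ : v μ = ρ := hμ
  have hμ0 : μ ≠ 0 := by
    rintro rfl
    rw [map_zero] at hμ
    exact hρ.ne hμ
  refine le_iSup₂_of_le (f := fun μ _ => (baseChangeEnd β).maxGenEigenspace μ) μ⁻¹
    (by simp [hμ]) ?_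
  exact maxGen_inv _ _ hBA hAB μ hμ0


/-- Growth bound on generalized eigenspaces. -/
lemma growth_maxGen {F M : Type*} [Field F] [AddCommGroup M] [Module F M]
    (v : AbsoluteValue F ℝ) (hnat : ∀ n : ℕ, v (n : F) ≤ 1)
    (N : M → ℝ) (hN0 : N 0 = 0) (hNn : ∀ x, 0 ≤ N x) (hadd : ∀ x y, N (x + y) ≤ N x + N y)
    (hsmul : ∀ (c : F) x, N (c • x) = v c * N x)
    (A : Module.End F M) (μ : F) (hμ : v μ ≤ 1) (y : M) (hy : y ∈ A.maxGenEigenspace μ) :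
    ∃ (C : ℝ) (d : ℕ), 0 ≤ C ∧ ∀ n : ℕ, N ((A ^ n) y) ≤ C * v μ ^ (n - d) := by
  rw [Module.End.mem_maxGenEigenspace] at hy
  obtain ⟨d, hd⟩ := hy
  refine ⟨∑ k ∈ Finset.range d, N (((A - μ • 1) ^ k) y), d,
    Finset.sum_nonneg fun k _ => hNn _, fun n => ?_⟩
  set B := A - μ • (1 : Module.End F M) with hB
  have hA : A = B + μ • 1 := by rw [hB]; abel
  have hc : Commute B (μ • (1 : Module.End F M)) := (Commute.one_right B).smul_right μ
  have hz : ∀ k, d ≤ k → (B ^ k) y = 0 := fun k hk => by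
    obtain ⟨j, rfl⟩ := Nat.exists_eq_add_of_le' hk
    rw [pow_add, Module.End.mul_apply, hd, map_zero]
  have hexp : (A ^ n) y = ∑ k ∈ Finset.range (n + 1),
      ((n.choose k : F) * μ ^ (n - k)) • (B ^ k) y := by
    rw [hA, hc.add_pow, LinearMap.sum_apply]
    refine Finset.sum_congr rfl fun k _ => ?_
    rw [smul_pow, one_pow, mul_smul_comm, mul_one, ← (Nat.cast_commute _ _).eq,
      Module.End.mul_apply, Module.End.natCast_apply, LinearMap.smul_apply, mul_smul,
      Nat.cast_smul_eq_nsmul]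
  calc N ((A ^ n) y) ≤ ∑ k ∈ Finset.range (n + 1),
        N (((n.choose k : F) * μ ^ (n - k)) • (B ^ k) y) := by
        rw [hexp]; exact Finset.le_sum_of_subadditive N hN0.le hadd _ _
    _ ≤ ∑ k ∈ Finset.range (n + 1), (if k < d then N ((B ^ k) y) * v μ ^ (n - d) else 0) := by
        refine Finset.sum_le_sum fun k _ => ?_
        split_ifs with h
        · rw [hsmul, v.map_mul, v.map_pow, mul_comm]
          refine mul_le_mul_of_nonneg_left ?_ (hNn _)
          calc _ ≤ 1 * v μ ^ (n - k) :=
                mul_le_mul_of_nonneg_right (hnat _) (pow_nonneg (v.nonneg _) _)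
            _ = v μ ^ (n - k) := one_mul _
            _ ≤ _ := pow_le_pow_of_le_one (v.nonneg _) hμ (by omega)
        · rw [hz k (by omega), smul_zero, hN0]
    _ = ∑ k ∈ (Finset.range (n + 1)).filter (· < d), N ((B ^ k) y) * v μ ^ (n - d) :=
        (Finset.sum_filter _ _).symm
    _ ≤ ∑ k ∈ Finset.range d, N ((B ^ k) y) * v μ ^ (n - d) := by
        refine Finset.sum_le_sum_of_subset_of_nonneg (fun k hk => ?_)
          fun k _ _ => mul_nonneg (hNn _) (pow_nonneg (v.nonneg _) _)
        simp at hk ⊢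
        exact hk.2
    _ = _ := by rw [Finset.sum_mul]

lemma growth_iSup {F M : Type*} [Field F] [AddCommGroup M] [Module F M]
    (v : AbsoluteValue F ℝ) (hnat : ∀ n : ℕ, v (n : F) ≤ 1)
    (N : M → ℝ) (hN0 : N 0 = 0) (hNn : ∀ x, 0 ≤ N x) (hadd : ∀ x y, N (x + y) ≤ N x + N y)
    (hsmul : ∀ (c : F) x, N (c • x) = v c * N x)
    (A : Module.End F M) (ρ : ℝ) (hρ0 : 0 ≤ ρ) (hρ : ρ ≤ 1) (y : M)
    (hy : y ∈ ⨆ μ ∈ {μ : F | v μ = ρ}, A.maxGenEigenspace μ) :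
    ∃ (C : ℝ) (d : ℕ), 0 ≤ C ∧ ∀ n : ℕ, N ((A ^ n) y) ≤ C * ρ ^ (n - d) := by
  let S : Submodule F M :=
    { carrier := {y | ∃ (C : ℝ) (d : ℕ), 0 ≤ C ∧ ∀ n : ℕ, N ((A ^ n) y) ≤ C * ρ ^ (n - d)}
      zero_mem' := ⟨0, 0, le_rfl, fun n => by simp [hN0]⟩
      add_mem' := by
        rintro a b ⟨C, d, hC, h⟩ ⟨C', d', hC', h'⟩
        refine ⟨C + C', max d d', add_nonneg hC hC', fun n => ?_⟩
        rw [map_add, add_mul]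
        refine (hadd _ _).trans (add_le_add ((h n).trans ?_) ((h' n).trans ?_))
        · exact mul_le_mul_of_nonneg_left (pow_le_pow_of_le_one hρ0 hρ (by omega)) hC
        · exact mul_le_mul_of_nonneg_left (pow_le_pow_of_le_one hρ0 hρ (by omega)) hC'
      smul_mem' := by
        rintro c a ⟨C, d, hC, h⟩
        refine ⟨v c * C, d, mul_nonneg (v.nonneg _) hC, fun n => ?_⟩
        rw [map_smul, hsmul, mul_assoc]
        exact mul_le_mul_of_nonneg_left (h n) (v.nonneg _) }
  have : (⨆ μ ∈ {μ : F | v μ = ρ}, A.maxGenEigenspace μ) ≤ S := by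
    refine iSup₂_le fun μ hμ => ?_
    intro z hz
    have hμ : v μ = ρ := hμ
    subst hμ
    exact growth_maxGen v hnat N hN0 hNn hadd hsmul A μ hρ z hz
  exact this hy

lemma growth_spec {K E : Type*} [NontriviallyNormedField K]
    [LocallyCompactSpace K] [TotallyDisconnectedSpace K]
    [NormedAddCommGroup E] [NormedSpace K E] [FiniteDimensional K E]
    (v : AbsoluteValue (AlgebraicClosure K) ℝ)
    (hvext : ∀ t : K, v (algebraMap K (AlgebraicClosure K) t) = ‖t‖)
    (α : E →ₗ[K] E) (ρ : ℝ) (hρ0 : 0 ≤ ρ) (hρ : ρ ≤ 1) (x : E) (hx : x ∈ specSubspace v α ρ) :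
    ∃ (C : ℝ) (d : ℕ), 0 ≤ C ∧ ∀ n : ℕ, ‖(α ^ n) x‖ ≤ C * ρ ^ (n - d) := by
  let b := Module.finBasis K E
  let b' := b.baseChange (AlgebraicClosure K)
  have hnat : ∀ n : ℕ, v (n : AlgebraicClosure K) ≤ 1 := fun n => by
    rw [← map_natCast (algebraMap K (AlgebraicClosure K)), hvext]
    exact norm_natCast_le_one_of_td n
  obtain ⟨C, d, hC, h⟩ := growth_iSup v hnat (fun y => ∑ i, ‖b i‖ * v (b'.repr y i)) (by simp)
    (fun y => Finset.sum_nonneg fun i _ => mul_nonneg (norm_nonneg _) (v.nonneg _))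
    (fun y z => by
      rw [← Finset.sum_add_distrib]
      refine Finset.sum_le_sum fun i _ => ?_
      rw [← mul_add, map_add, Finsupp.add_apply]
      exact mul_le_mul_of_nonneg_left (v.add_le _ _) (norm_nonneg _))
    (fun c y => by
      rw [Finset.mul_sum]
      refine Finset.sum_congr rfl fun i _ => ?_
      rw [map_smul, Finsupp.smul_apply, smul_eq_mul, v.map_mul]; ring)
    (baseChangeEnd α) ρ hρ0 hρ (1 ⊗ₜ[K] x) hx
  refine ⟨C, d, hC, fun n => le_trans ?_ (h n)⟩
  rw [baseChange_pow_tmul]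
  conv_lhs => rw [← b.sum_repr ((α ^ n) x)]
  refine (norm_sum_le _ _).trans (Finset.sum_le_sum fun i _ => ?_)
  rw [norm_smul, mul_comm]
  refine le_of_eq ?_
  congr 1
  rw [Module.Basis.baseChange_repr_tmul, Algebra.smul_def, mul_one, hvext]

/-- vectors contracted by `α`. -/
def contr {K E : Type*} [NontriviallyNormedField K]
    [NormedAddCommGroup E] [NormedSpace K E] (α : E →ₗ[K] E) : Submodule K E where
  carrier := {x | Tendsto (fun n : ℕ => (α ^ n) x) atTop (𝓝 0)}
  zero_mem' := by simp
  add_mem' := fun {a b} ha hb => by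
    have := Tendsto.add ha hb
    simpa using this
  smul_mem' := fun c a ha => by
    have := Tendsto.const_smul ha c
    simpa using this

/-- vectors with bounded forward orbit under `α`. -/
def bdd {K E : Type*} [NontriviallyNormedField K]
    [NormedAddCommGroup E] [NormedSpace K E] (α : E →ₗ[K] E) : Submodule K E where
  carrier := {x | ∃ C : ℝ, ∀ n : ℕ, ‖(α ^ n) x‖ ≤ C}
  zero_mem' := ⟨0, by simp⟩
  add_mem' := fun {a b} ⟨C, ha⟩ ⟨D, hb⟩ => ⟨C + D, fun n => by
    rw [map_add]
    exact (norm_add_le _ _).trans (add_le_add (ha n) (hb n))⟩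
  smul_mem' := fun c a ⟨C, ha⟩ => ⟨‖c‖ * C, fun n => by
    rw [map_smul, norm_smul]
    exact mul_le_mul_of_nonneg_left (ha n) (norm_nonneg _)⟩

lemma contr_le_bdd {K E : Type*} [NontriviallyNormedField K]
    [NormedAddCommGroup E] [NormedSpace K E] (α : E →ₗ[K] E) : contr α ≤ bdd α := by
  intro x hx
  have hx : Tendsto (fun n : ℕ => (α ^ n) x) atTop (𝓝 0) := hx
  obtain ⟨C, hC⟩ := (Metric.isBounded_range_of_tendsto _ hx).exists_norm_le
  exact ⟨C, fun n => hC _ ⟨n, rfl⟩⟩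

lemma contr_inf_bdd {K E : Type*} [NontriviallyNormedField K] [CompleteSpace K]
    [NormedAddCommGroup E] [NormedSpace K E] [FiniteDimensional K E] (α β : E →ₗ[K] E)
    (hαβ : α * β = 1) (x : E) (hx : x ∈ contr α) (hb : x ∈ bdd β) : x = 0 := by
  have hcomm : Commute α β := by
    have : β * α = 1 := mul_eq_one_comm.mp hαβ
    exact hαβ.trans this.symm
  have hmem : ∀ n : ℕ, (β ^ n) x ∈ contr α := fun n => by
    change Tendsto (fun m : ℕ => (α ^ m) ((β ^ n) x)) atTop (𝓝 0)
    have h1 : ∀ m : ℕ, (α ^ m) ((β ^ n) x) = (β ^ n) ((α ^ m) x) := fun m => by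
      rw [← Module.End.mul_apply, (hcomm.pow_pow m n).eq, Module.End.mul_apply]
    simp_rw [h1]
    have := ((β ^ n).continuous_of_finiteDimensional.tendsto 0).comp
      (show Tendsto (fun n : ℕ => (α ^ n) x) atTop (𝓝 0) from hx)
    rw [map_zero] at this
    exact this
  obtain ⟨C, hC⟩ := hb
  let b := Module.finBasis K (contr α)
  let L : contr α →L[K] (Fin (Module.finrank K (contr α)) → K) :=
    LinearMap.toContinuousLinearMap b.equivFun
  have hle : ∀ n : ℕ, ‖x‖ ≤ ∑ i, (‖L‖ * C) * ‖(α ^ n) (b i : E)‖ := fun n => by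
    let z : contr α := ⟨(β ^ n) x, hmem n⟩
    have h1 : (α ^ n) (z : E) = x := by
      change (α ^ n) ((β ^ n) x) = x
      rw [← Module.End.mul_apply, ← hcomm.mul_pow, hαβ, one_pow, Module.End.one_apply]
    have h2 : (z : E) = ∑ i, (L z i) • (b i : E) := by
      have := congrArg (contr α).subtype (b.sum_equivFun z).symm
      rw [map_sum] at this
      exact this
    have h3 : ‖z‖ ≤ C := hC n
    rw [← h1, h2, map_sum]
    refine (norm_sum_le _ _).trans (Finset.sum_le_sum fun i _ => ?_)
    rw [map_smul, norm_smul]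
    refine mul_le_mul_of_nonneg_right ?_ (norm_nonneg _)
    exact (norm_le_pi_norm (L z) i).trans ((L.le_opNorm z).trans
      (mul_le_mul_of_nonneg_left h3 (norm_nonneg _)))
  have hlim : Tendsto (fun n : ℕ => ∑ i, (‖L‖ * C) * ‖(α ^ n) (b i : E)‖) atTop (𝓝 0) := by
    have : Tendsto (fun n : ℕ => ∑ i, (‖L‖ * C) * ‖(α ^ n) (b i : E)‖) atTop
        (𝓝 (∑ i : Fin (Module.finrank K (contr α)), (‖L‖ * C) * ‖(0 : E)‖)) :=
      tendsto_finsetSum _ fun i _ => ((show Tendsto (fun n : ℕ => (α ^ n) (b i : E)) atTop (𝓝 0)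
        from (b i).2).norm).const_mul _
    simpa using this
  exact norm_le_zero_iff.mp (ge_of_tendsto' hlim hle)

lemma spec_le_bdd {K E : Type*} [NontriviallyNormedField K]
    [LocallyCompactSpace K] [TotallyDisconnectedSpace K]
    [NormedAddCommGroup E] [NormedSpace K E] [FiniteDimensional K E]
    (v : AbsoluteValue (AlgebraicClosure K) ℝ)
    (hvext : ∀ t : K, v (algebraMap K (AlgebraicClosure K) t) = ‖t‖)
    (α : E →ₗ[K] E) : specSubspace v α 1 ≤ bdd α := by
  intro x hx
  obtain ⟨C, d, -, h⟩ := growth_spec v hvext α 1 zero_le_one le_rfl x hx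
  exact ⟨C, fun n => by simpa using h n⟩

lemma spec_le_contr {K E : Type*} [NontriviallyNormedField K]
    [LocallyCompactSpace K] [TotallyDisconnectedSpace K]
    [NormedAddCommGroup E] [NormedSpace K E] [FiniteDimensional K E]
    (v : AbsoluteValue (AlgebraicClosure K) ℝ)
    (hvext : ∀ t : K, v (algebraMap K (AlgebraicClosure K) t) = ‖t‖)
    (α : E →ₗ[K] E) (ρ : ℝ) (hρ0 : 0 ≤ ρ) (hρ : ρ < 1) : specSubspace v α ρ ≤ contr α := by
  intro x hx
  obtain ⟨C, d, -, h⟩ := growth_spec v hvext α ρ hρ0 hρ.le x hx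
  refine squeeze_zero_norm h ?_
  have := ((tendsto_pow_atTop_nhds_zero_of_lt_one hρ0 hρ).comp (tendsto_sub_atTop_nat d)).const_mul C
  simpa using this

lemma coe_pow_apply {K E : Type*} [Field K] [AddCommGroup E] [Module K E] (α : E ≃ₗ[K] E)
    (n : ℕ) (x : E) : (α ^ n) x = ((α : E →ₗ[K] E) ^ n) x := by
  induction n generalizing x with
  | zero => rfl
  | succ n ih => rw [pow_succ, pow_succ, LinearEquiv.mul_apply, Module.End.mul_apply, ih]; rfl

end Helpers


/-- For a linear automorphism `α` of a finite-dimensional vector space over a local field: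
the contraction group `U_α` equals `⊕_{ρ<1} E_ρ`, the Levi factor `M_α` equals `E_1`,
`U_{α⁻¹}` equals `⊕_{ρ>1} E_ρ`, and `E = U_α ⊕ M_α ⊕ U_{α⁻¹}`. -/
theorem linear_contraction_levi_decomposition {K : Type*} [NontriviallyNormedField K]
    [CompleteSpace K] [LocallyCompactSpace K] [TotallyDisconnectedSpace K]
    {E : Type*} [NormedAddCommGroup E] [NormedSpace K E] [FiniteDimensional K E]
    (v : AbsoluteValue (AlgebraicClosure K) ℝ)
    (hvext : ∀ t : K, v (algebraMap K (AlgebraicClosure K) t) = ‖t‖)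
    (α : E ≃ₗ[K] E) :
    {x : E | Tendsto (fun n : ℕ => (α ^ n) x) atTop (𝓝 0)} =
        ↑(⨆ ρ ∈ {ρ ∈ eigAbs v (α : E →ₗ[K] E) | ρ < 1},
            specSubspace v (α : E →ₗ[K] E) ρ) ∧
      {x : E | IsCompact (closure (Set.range fun n : ℤ => (α ^ n) x))} =
        ↑(specSubspace v (α : E →ₗ[K] E) 1) ∧
      {x : E | Tendsto (fun n : ℕ => (α⁻¹ ^ n) x) atTop (𝓝 0)} =
        ↑(⨆ ρ ∈ {ρ ∈ eigAbs v (α : E →ₗ[K] E) | 1 < ρ},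
            specSubspace v (α : E →ₗ[K] E) ρ) ∧
      ((⨆ ρ ∈ {ρ ∈ eigAbs v (α : E →ₗ[K] E) | ρ < 1}, specSubspace v (α : E →ₗ[K] E) ρ) ⊔
          specSubspace v (α : E →ₗ[K] E) 1 ⊔
          (⨆ ρ ∈ {ρ ∈ eigAbs v (α : E →ₗ[K] E) | 1 < ρ},
            specSubspace v (α : E →ₗ[K] E) ρ) = ⊤) ∧
      ((⨆ ρ ∈ {ρ ∈ eigAbs v (α : E →ₗ[K] E) | ρ < 1}, specSubspace v (α : E →ₗ[K] E) ρ) ⊓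
          specSubspace v (α : E →ₗ[K] E) 1 = ⊥) ∧
      (((⨆ ρ ∈ {ρ ∈ eigAbs v (α : E →ₗ[K] E) | ρ < 1}, specSubspace v (α : E →ₗ[K] E) ρ) ⊔
          specSubspace v (α : E →ₗ[K] E) 1) ⊓
          (⨆ ρ ∈ {ρ ∈ eigAbs v (α : E →ₗ[K] E) | 1 < ρ},
            specSubspace v (α : E →ₗ[K] E) ρ) = ⊥) := by
  set A : E →ₗ[K] E := (α : E →ₗ[K] E) with hA
  set B : E →ₗ[K] E := ((α⁻¹ : E ≃ₗ[K] E) : E →ₗ[K] E) with hB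
  have hAB : A * B = 1 := by
    ext x; exact α.apply_symm_apply x
  have hBA : B * A = 1 := by
    ext x; exact α.symm_apply_apply x
  have htop := spec_sup_eq_top v hvext A
  have hQA : specSubspace v A 1 ≤ bdd A := spec_le_bdd v hvext A
  have hQB : specSubspace v A 1 ≤ bdd B := by
    have := specSubspace_inv v A B hBA hAB 1 one_pos
    rw [inv_one] at this
    exact this.trans (spec_le_bdd v hvext B)
  have hP : (⨆ ρ ∈ {ρ ∈ eigAbs v A | ρ < 1}, specSubspace v A ρ) ≤ contr A := by
    refine iSup₂_le fun ρ hρ => ?_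
    obtain ⟨⟨μ, -, rfl⟩, h1⟩ := hρ
    exact spec_le_contr v hvext A _ (v.nonneg _) h1
  have hR : (⨆ ρ ∈ {ρ ∈ eigAbs v A | 1 < ρ}, specSubspace v A ρ) ≤ contr B := by
    refine iSup₂_le fun ρ hρ => ?_
    have h1 : 1 < ρ := hρ.2
    have h0 : 0 < ρ := one_pos.trans h1
    exact (specSubspace_inv v A B hBA hAB ρ h0).trans
      (spec_le_contr v hvext B _ (inv_nonneg.mpr h0.le) (inv_lt_one_of_one_lt₀ h1))
  generalize (⨆ ρ ∈ {ρ ∈ eigAbs v A | ρ < 1}, specSubspace v A ρ) = P at *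
  generalize (⨆ ρ ∈ {ρ ∈ eigAbs v A | 1 < ρ}, specSubspace v A ρ) = R at *
  generalize specSubspace v A 1 = Q at *
  have hdec : ∀ x : E, ∃ p ∈ P, ∃ q ∈ Q, ∃ r ∈ R, x = p + q + r := fun x => by
    have hx : x ∈ P ⊔ Q ⊔ R := htop ▸ Submodule.mem_top
    obtain ⟨y, hy, r, hr, rfl⟩ := Submodule.mem_sup.mp hx
    obtain ⟨p, hp, q, hq, rfl⟩ := Submodule.mem_sup.mp hy
    exact ⟨p, hp, q, hq, r, hr, rfl⟩
  have hPb := hP.trans (contr_le_bdd A)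
  have hRb := hR.trans (contr_le_bdd B)
  have hzA : ∀ x, x ∈ contr A → x ∈ bdd B → x = 0 := contr_inf_bdd A B hAB
  have hzB : ∀ x, x ∈ contr B → x ∈ bdd A → x = 0 := contr_inf_bdd B A hBA
  have hPeq : P = contr A := by
    refine le_antisymm hP fun x hx => ?_
    obtain ⟨p, hp, q, hq, r, hr, rfl⟩ := hdec x
    have h1 : q + r ∈ contr A := by
      have := Submodule.sub_mem _ hx (hP hp)
      rwa [add_assoc, add_sub_cancel_left] at this
    have h2 := hzA _ h1 (Submodule.add_mem _ (hQB hq) (hRb hr))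
    rwa [add_assoc, h2, add_zero]
  have hReq : R = contr B := by
    refine le_antisymm hR fun x hx => ?_
    obtain ⟨p, hp, q, hq, r, hr, rfl⟩ := hdec x
    have h1 : p + q ∈ contr B := by
      have := Submodule.sub_mem _ hx (hR hr)
      rwa [add_sub_cancel_right] at this
    have h2 := hzB _ h1 (Submodule.add_mem _ (hPb hp) (hQA hq))
    rwa [h2, zero_add]
  have hQeq : Q = bdd A ⊓ bdd B := by
    refine le_antisymm (le_inf hQA hQB) fun x hx => ?_
    obtain ⟨hxA, hxB⟩ := hx
    obtain ⟨p, hp, q, hq, r, hr, rfl⟩ := hdec x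
    have h1 : p = 0 := hzA p (hP hp) (by
      have := Submodule.sub_mem _ (Submodule.sub_mem _ hxB (hRb hr)) (hQB hq)
      simpa using this)
    have h2 : r = 0 := hzB r (hR hr) (by
      have := Submodule.sub_mem _ hxA (Submodule.add_mem _ (hPb hp) (hQA hq))
      simpa using this)
    rwa [h1, h2, zero_add, add_zero]
  refine ⟨?_, ?_, ?_, htop, ?_, ?_⟩
  · rw [hPeq]
    ext x
    simp only [coe_pow_apply]
    rfl
  · rw [hQeq]
    ext x
    have : ProperSpace E := FiniteDimensional.proper K E
    rw [Set.mem_setOf_eq, SetLike.mem_coe, Submodule.mem_inf]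
    constructor
    · intro h
      obtain ⟨C, hC⟩ := (h.isBounded.subset subset_closure).exists_norm_le
      refine ⟨⟨C, fun n => ?_⟩, ⟨C, fun n => ?_⟩⟩
      · rw [hA, ← coe_pow_apply]
        exact hC _ ⟨n, by simp⟩
      · rw [hB, ← coe_pow_apply]
        exact hC _ ⟨-n, by simp⟩
    · rintro ⟨⟨C, hC⟩, ⟨D, hD⟩⟩
      refine Bornology.IsBounded.isCompact_closure ?_
      rw [isBounded_iff_forall_norm_le]
      refine ⟨max C D, ?_⟩
      rintro _ ⟨n, rfl⟩
      obtain ⟨m, rfl | rfl⟩ := n.eq_nat_or_neg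
      · refine le_trans ?_ (le_max_left C D)
        have := hC m
        rw [hA, ← coe_pow_apply] at this
        simpa using this
      · refine le_trans ?_ (le_max_right C D)
        have := hD m
        rw [hB, ← coe_pow_apply] at this
        simpa using this
  · rw [hReq]
    ext x
    simp only [coe_pow_apply]
    rfl
  · rw [eq_bot_iff]
    rintro x ⟨hp, hq⟩
    exact hzA x (hP hp) (hQB hq)
  · rw [eq_bot_iff]
    rintro x ⟨hpq, hr⟩
    exact hzB x (hR hr) ((sup_le hPb hQA) hpq)
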